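/- Let G = (V, E) be a finite simple graph with V nonempty. The spatial cost of G equals the pathwidth of G plus one: sc(G) = pw(G) + 1. Equivalently, the minimum over all measurement schedules X₁, …, Xₙ on G of maxᵢ |Xᵢ| equals one plus the minimum over all path decompositions X₁, …, Xₙ of G of (maxᵢ |Xᵢ| − 1). -/

import Mathlib

/-- Condition M1: each vertex appears in a nonempty, consecutive (interval) set of bags. -/
def CondM1 {V : Type*} {n : ℕ} (X : Fin n → Finset V) : Prop :=
  ∀ v : V, (∃ i, v ∈ X i) ∧
    ∀ i j k : Fin n, i ≤ j → j ≤ k → v ∈ X i → v ∈ X k → v ∈ X j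

/-- Condition M2: if `k` is the largest index with `v ∈ X k`, then every neighbour of `v`
belongs to some bag with index at most `k`. -/
def CondM2 {V : Type*} (G : SimpleGraph V) {n : ℕ} (X : Fin n → Finset V) : Prop :=
  ∀ v : V, ∀ k : Fin n, v ∈ X k → (∀ k' : Fin n, v ∈ X k' → k' ≤ k) →
    ∀ u : V, G.Adj u v → ∃ j : Fin n, j ≤ k ∧ u ∈ X j

/-- A measurement schedule on the graph state `|G⟩`. -/
def IsMeasurementSchedule {V : Type*} (G : SimpleGraph V) {n : ℕ} (X : Fin n → Finset V) :
    Prop :=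
  CondM1 X ∧ CondM2 G X

/-- Condition P1: every vertex lies in some bag. -/
def CondP1 {V : Type*} {n : ℕ} (X : Fin n → Finset V) : Prop :=
  ∀ v : V, ∃ i, v ∈ X i

/-- Condition P2: every edge is contained in some bag. -/
def CondP2 {V : Type*} (G : SimpleGraph V) {n : ℕ} (X : Fin n → Finset V) : Prop :=
  ∀ u v : V, G.Adj u v → ∃ i : Fin n, u ∈ X i ∧ v ∈ X i

/-- Condition P3: the bags containing a given vertex form an interval. -/
def CondP3 {V : Type*} {n : ℕ} (X : Fin n → Finset V) : Prop :=
  ∀ i j k : Fin n, i ≤ j → j ≤ k → ∀ v : V, v ∈ X i → v ∈ X k → v ∈ X j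

/-- A path decomposition of the graph `G`. -/
def IsPathDecomposition {V : Type*} (G : SimpleGraph V) {n : ℕ} (X : Fin n → Finset V) :
    Prop :=
  CondP1 X ∧ CondP2 G X ∧ CondP3 X

/-- The cost of a schedule / maximum bag size of a decomposition. -/
def maxBagSize {V : Type*} {n : ℕ} (X : Fin n → Finset V) : ℕ :=
  Finset.univ.sup fun i => (X i).card

/-- The spatial cost of the graph state `|G⟩`: the minimum over all measurement
schedules of the maximum number of simultaneously active qubits. -/
noncomputable def spatialCost {V : Type*} (G : SimpleGraph V) : ℕ :=
  sInf {c : ℕ | ∃ (n : ℕ) (X : Fin n → Finset V),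
    IsMeasurementSchedule G X ∧ c = maxBagSize X}

/-- The pathwidth of `G`: the minimum width over all path decompositions of `G`. -/
noncomputable def pathwidth {V : Type*} (G : SimpleGraph V) : ℕ :=
  sInf {w : ℕ | ∃ (n : ℕ) (X : Fin n → Finset V),
    IsPathDecomposition G X ∧ w = maxBagSize X - 1}

/-- A vertex covered by some bag has a last bag containing it. -/
theorem CondP1.exists_last {V : Type*} {n : ℕ} {X : Fin n → Finset V} (h : CondP1 X) (v : V) :
    ∃ k : Fin n, v ∈ X k ∧ ∀ k' : Fin n, v ∈ X k' → k' ≤ k :=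
  Set.exists_max_image {i | v ∈ X i} id (Set.toFinite _) (h v)

theorem condM1_iff {V : Type*} {n : ℕ} {X : Fin n → Finset V} :
    CondM1 X ↔ CondP1 X ∧ CondP3 X :=
  ⟨fun h => ⟨fun v => (h v).1, fun i j k hij hjk v => (h v).2 i j k hij hjk⟩,
    fun h v => ⟨h.1 v, fun i j k hij hjk => h.2 i j k hij hjk v⟩⟩

theorem isMeasurementSchedule_iff_isPathDecomposition {V : Type*} {G : SimpleGraph V} {n : ℕ}
    {X : Fin n → Finset V} : IsMeasurementSchedule G X ↔ IsPathDecomposition G X := by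
  rw [IsMeasurementSchedule, condM1_iff]
  constructor
  · rintro ⟨⟨h₁, h₃⟩, h₂⟩
    refine ⟨h₁, fun u v huv => ?_, h₃⟩
    obtain ⟨k, hk, hk_last⟩ := h₁.exists_last u
    obtain ⟨l, hl, hl_last⟩ := h₁.exists_last v
    rcases le_total k l with hkl | hlk
    · obtain ⟨j, hj, hv⟩ := h₂ u k hk hk_last v huv.symm
      exact ⟨k, hk, h₃ j k l hj hkl v hv hl⟩
    · obtain ⟨j, hj, hu⟩ := h₂ v l hl hl_last u huv
      exact ⟨l, h₃ j l k hj hlk u hu hk, hl⟩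
  · rintro ⟨h₁, h₂, h₃⟩
    refine ⟨⟨h₁, h₃⟩, fun v k _ hk_last u huv => ?_⟩
    obtain ⟨i, hu, hv⟩ := h₂ u v huv
    exact ⟨i, hk_last i hv, hu⟩

theorem CondP1.maxBagSize_pos {V : Type*} [Nonempty V] {n : ℕ} {X : Fin n → Finset V}
    (h : CondP1 X) : 0 < maxBagSize X := by
  obtain ⟨i, hi⟩ := h (Classical.arbitrary V)
  exact (Finset.card_pos.2 ⟨_, hi⟩).trans_le
    (Finset.le_sup (f := fun i => (X i).card) (Finset.mem_univ i))

theorem isPathDecomposition_const_univ {V : Type*} [Fintype V] (G : SimpleGraph V) :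
    IsPathDecomposition G (fun _ : Fin 1 => Finset.univ) :=
  ⟨fun v => ⟨0, Finset.mem_univ v⟩,
    fun u v _ => ⟨0, Finset.mem_univ u, Finset.mem_univ v⟩,
    fun _ _ _ _ _ v _ _ => Finset.mem_univ v⟩

/-- The spatial cost of `|G⟩` equals the pathwidth of `G` plus one. -/
theorem spatialCost_eq_pathwidth_add_one {V : Type*} [Fintype V] [Nonempty V]
    (G : SimpleGraph V) : spatialCost G = pathwidth G + 1 := by
  simp only [spatialCost, pathwidth, isMeasurementSchedule_iff_isPathDecomposition]
  have hG := isPathDecomposition_const_univ G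
  apply le_antisymm
  · obtain ⟨n, X, hX, hw⟩ := Nat.sInf_mem
      (s := {w : ℕ | ∃ (n : ℕ) (X : Fin n → Finset V),
        IsPathDecomposition G X ∧ w = maxBagSize X - 1}) ⟨_, _, _, hG, rfl⟩
    rw [hw, Nat.sub_add_cancel hX.1.maxBagSize_pos]
    exact Nat.sInf_le ⟨n, X, hX, rfl⟩
  · obtain ⟨n, X, hX, hc⟩ := Nat.sInf_mem
      (s := {c : ℕ | ∃ (n : ℕ) (X : Fin n → Finset V),
        IsPathDecomposition G X ∧ c = maxBagSize X}) ⟨_, _, _, hG, rfl⟩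
    rw [hc, ← Nat.le_sub_iff_add_le hX.1.maxBagSize_pos]
    exact Nat.sInf_le ⟨n, X, hX, rfl⟩
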